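/- If f ∈ Γ₀(ℝⁿ) satisfies the quadratic growth condition f(x) − min f ≥ (α/2)·d(x, Argmin f)² on a set Ω, then its Moreau envelope f_λ satisfies f_λ(x) − min f ≥ (c/2)·d(x, Argmin f)² on Ω with c = min{α/2, 1/(2λ)}. -/

import Mathlib

open scoped RealInnerProductSpace

/-- If `f ∈ Γ₀` satisfies the quadratic growth condition
`f(x) − min f ≥ (α/2)·d(x, Argmin f)²` on `Ω`, then the Moreau envelope
`f_λ(x) = f(prox_{λf}(x)) + (1/(2λ))‖x − prox_{λf}(x)‖²` satisfies
`f_λ(x) − min f ≥ (c/2)·d(x, Argmin f)²` on `Ω` with `c = min{α/2, 1/(2λ)}`. -/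
theorem stmt11 {n : ℕ} (f : EuclideanSpace ℝ (Fin n) → ℝ)
    (hconv : ConvexOn ℝ Set.univ f) (hlsc : LowerSemicontinuous f)
    (m : ℝ) (hm : ∀ x, m ≤ f x) (hach : ∃ x, f x = m)
    (lam : ℝ) (hlam : 0 < lam)
    (P : EuclideanSpace ℝ (Fin n) → EuclideanSpace ℝ (Fin n))
    (hP : ∀ x y, f (P x) + (1/(2*lam)) * ‖x - P x‖^2 ≤ f y + (1/(2*lam)) * ‖x - y‖^2)
    (Ω : Set (EuclideanSpace ℝ (Fin n)))
    (hΩ : ∀ x ∈ Ω, P x ∈ Ω)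
    (α : ℝ) (hα : 0 < α)
    (hqg : ∀ x ∈ Ω, (α/2) * (Metric.infDist x {z | ∀ y, f z ≤ f y})^2 ≤ f x - m) :
    ∀ x ∈ Ω, (min (α/2) (1/(2*lam)) / 2) * (Metric.infDist x {z | ∀ y, f z ≤ f y})^2
      ≤ (f (P x) + (1/(2*lam)) * ‖x - P x‖^2) - m := by
  intro x hx
  have hd := Metric.infDist_le_infDist_add_dist (s := {z | ∀ y, f z ≤ f y}) (x := x) (y := P x)
  rw [dist_eq_norm] at hd
  have hgrowth := hqg (P x) (hΩ x hx)
  have hd0 := Metric.infDist_nonneg (s := {z | ∀ y, f z ≤ f y}) (x := x)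
  set d := Metric.infDist x {z | ∀ y, f z ≤ f y}
  set a := Metric.infDist (P x) {z | ∀ y, f z ≤ f y}
  set b := ‖x - P x‖
  set c := min (α / 2) (1 / (2 * lam))
  have hc : 0 ≤ c := le_min (by positivity) (by positivity)
  have hsq : d ^ 2 ≤ 2 * (a ^ 2 + b ^ 2) :=
    (pow_le_pow_left₀ hd0 hd 2).trans add_sq_le
  calc c / 2 * d ^ 2 ≤ c / 2 * (2 * (a ^ 2 + b ^ 2)) := by gcongr
    _ = c * a ^ 2 + c * b ^ 2 := by ring
    _ ≤ α / 2 * a ^ 2 + 1 / (2 * lam) * b ^ 2 := by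
      gcongr
      · exact min_le_left _ _
      · exact min_le_right _ _
    _ ≤ f (P x) + 1 / (2 * lam) * b ^ 2 - m := by linarith
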